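/- arXiv:2405.08736 — 4 statements merged into one kernel-verified Lean document; each statement's English description precedes it below -/
import Mathlib

section
/- Let a, g : ℝ × ℝ → ℝ be continuous, let x : ℝ → ℝ be continuous, let 0 ≤ tₙ < t_{n+1} < 1, set h = t_{n+1} − tₙ, and suppose |a(s, x(s))| ≤ C₀ and |g(s, x(s))| ≤ C₃ for all s ∈ [tₙ, t_{n+1}]. Then ( ∫_{tₙ}^{t_{n+1}} ∫_{tₙ}^{t} ( −a(s, x(s))/(1−s) + g(s, x(s)) ) ds dt )² ≤ 2C₀²h⁴/(1−t_{n+1})² + (C₃²/2)·h⁴. -/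
/-- An iterated integral over the triangle `a ≤ s ≤ t ≤ b` of a function bounded by `K` is at most
`K` times the area of the triangle. -/
theorem abs_integral_integral_le_of_abs_le {f : ℝ → ℝ} {a b K : ℝ} (hab : a ≤ b)
    (hf : ∀ s ∈ Set.Icc a b, |f s| ≤ K) :
    |∫ t in a..b, ∫ s in a..t, f s| ≤ K * (b - a) ^ 2 / 2 := by
  have inner_le : ∀ t ∈ Set.Ioc a b, ‖∫ s in a..t, f s‖ ≤ K * (t - a) := by
    intro t ht
    rw [← abs_of_nonneg (sub_nonneg.2 ht.1.le)]
    refine intervalIntegral.norm_integral_le_of_norm_le_const fun s hs => ?_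
    rw [Set.uIoc_of_le ht.1.le] at hs
    exact hf s ⟨hs.1.le, hs.2.trans ht.2⟩
  calc |∫ t in a..b, ∫ s in a..t, f s|
      ≤ ∫ t in a..b, K * (t - a) :=
        intervalIntegral.norm_integral_le_of_norm_le hab (.of_forall inner_le)
          (Continuous.intervalIntegrable (by fun_prop) a b)
    _ = K * (b - a) ^ 2 / 2 := by
        rw [intervalIntegral.integral_const_mul,
          intervalIntegral.integral_comp_sub_right (fun t => t), integral_id]
        ring

/-- Bound on the squared local truncation error `(L⁽²⁾ₙ)²` of the Euler update:
`(∫_{tₙ}^{t_{n+1}} ∫_{tₙ}^{t} (−a(s,x(s))/(1−s) + g(s,x(s))) ds dt)²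
  ≤ 2C₀²h⁴/(1−t_{n+1})² + (C₃²/2)h⁴` where `h = t_{n+1} − tₙ`. -/
theorem L2_truncation_bound (a g : ℝ × ℝ → ℝ) (x : ℝ → ℝ)
    (ha_cont : Continuous a) (hg_cont : Continuous g) (hx_cont : Continuous x)
    (tn tn1 C₀ C₃ : ℝ) (htn : 0 ≤ tn) (hlt : tn < tn1) (h1 : tn1 < 1)
    (hab : ∀ s ∈ Set.Icc tn tn1, |a (s, x s)| ≤ C₀)
    (hgb : ∀ s ∈ Set.Icc tn tn1, |g (s, x s)| ≤ C₃) :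
    (∫ t in tn..tn1, ∫ s in tn..t, (-a (s, x s) / (1 - s) + g (s, x s))) ^ 2 ≤
      2 * C₀ ^ 2 * (tn1 - tn) ^ 4 / (1 - tn1) ^ 2 + C₃ ^ 2 / 2 * (tn1 - tn) ^ 4 := by
  have h1' : 0 < 1 - tn1 := sub_pos.2 h1
  have integrand_le : ∀ s ∈ Set.Icc tn tn1,
      |-a (s, x s) / (1 - s) + g (s, x s)| ≤ C₀ / (1 - tn1) + C₃ := by
    intro s hs
    have hs1 : 1 - tn1 ≤ 1 - s := by linarith [hs.2]
    refine (abs_add_le _ _).trans (add_le_add ?_ (hgb s hs))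
    rw [abs_div, abs_neg, abs_of_pos (h1'.trans_le hs1)]
    exact div_le_div₀ ((abs_nonneg _).trans (hab s hs)) (hab s hs) h1' hs1
  calc (∫ t in tn..tn1, ∫ s in tn..t, (-a (s, x s) / (1 - s) + g (s, x s))) ^ 2
      ≤ ((C₀ / (1 - tn1) + C₃) * (tn1 - tn) ^ 2 / 2) ^ 2 :=
        sq_le_sq.2 ((abs_integral_integral_le_of_abs_le hlt.le integrand_le).trans (le_abs_self _))
    _ = (C₀ / (1 - tn1) + C₃) ^ 2 / 4 * (tn1 - tn) ^ 4 := by ring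
    _ ≤ (2 * (C₀ / (1 - tn1)) ^ 2 + C₃ ^ 2 / 2) * (tn1 - tn) ^ 4 := by
        gcongr
        linarith [add_sq_le (a := C₀ / (1 - tn1)) (b := C₃), sq_nonneg (C₀ / (1 - tn1))]
    _ = 2 * C₀ ^ 2 * (tn1 - tn) ^ 4 / (1 - tn1) ^ 2 + C₃ ^ 2 / 2 * (tn1 - tn) ^ 4 := by
        rw [div_pow]
        ring
end

section
/- Let a < b, let D = [a,b] × ℝ × ℝ, and let f : ℝ × ℝ × ℝ → ℝ be continuous on D with continuous partial derivatives ∂f/∂x and ∂f/∂x' on D. Suppose (i) ∂f/∂x(t, x, x') > 0 for all (t, x, x') ∈ D, and (ii) there exists M > 0 such that |∂f/∂x'(t, x, x')| ≤ M for all (t, x, x') ∈ D. Then for any real numbers α, β there exists a unique function x : [a,b] → ℝ, twice continuously differentiable on [a,b], satisfying x''(t) = f(t, x(t), x'(t)) for all t ∈ [a,b], x(a) = α, and x'(b) = β. -/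
open Set

/-- `x` is a solution of the mixed boundary value problem
`x'' = f(t, x, x')` on `[a,b]`, `x(a) = α`, `x'(b) = β`,
with `x` twice continuously differentiable on `[a,b]`
(derivatives taken within `[a,b]`). -/
def IsMixedBVPSolution (a b α β : ℝ) (f : ℝ → ℝ → ℝ → ℝ) (x : ℝ → ℝ) : Prop :=
  ContDiffOn ℝ 2 x (Icc a b) ∧
  (∀ t ∈ Icc a b,
    derivWithin (derivWithin x (Icc a b)) (Icc a b) t =
      f t (x t) (derivWithin x (Icc a b) t)) ∧
  x a = α ∧ derivWithin x (Icc a b) b = β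

/-- First-order necessary condition for a maximum on a compact interval. -/
lemma IsMaxOn.hasDerivWithinAt_mul_sub_nonpos {a b c t s : ℝ} {d : ℝ → ℝ}
    (hmax : IsMaxOn d (Icc a b) t) (hd : HasDerivWithinAt d c (Icc a b) t)
    (ht : t ∈ Icc a b) (hs : s ∈ Icc a b) : c * (s - t) ≤ 0 := by
  have hmem : s - t ∈ posTangentConeAt (Icc a b) t :=
    sub_mem_posTangentConeAt_of_segment_subset ((convex_Icc a b).segment_subset ht hs)
  simpa [mul_comm] using hmax.localize.hasFDerivWithinAt_nonpos hd.hasFDerivWithinAt hmem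

/-- One-sided second derivative test: a critical point with positive second derivative is not a
maximum, even at the right endpoint. -/
lemma exists_lt_of_deriv_eq_zero_of_second_deriv_pos {a b c t : ℝ} {d d' : ℝ → ℝ}
    (hd : ∀ s ∈ Icc a b, HasDerivWithinAt d (d' s) (Icc a b) s) (ht : t ∈ Ioc a b)
    (hzero : d' t = 0) (hd' : HasDerivWithinAt d' c (Icc a b) t) (hc : 0 < c) :
    ∃ s ∈ Icc a b, d t < d s := by
  have hlt : ∀ᶠ s in nhdsWithin t (Iio t), d' s < 0 := by
    have h : HasDerivWithinAt d' c (Ico a t) t :=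
      hd'.mono fun s hs => ⟨hs.1, hs.2.le.trans ht.2⟩
    rw [hasDerivWithinAt_iff_tendsto_slope' (by simp)] at h
    rw [← nhdsWithin_Ico_eq_nhdsLT ht.1]
    filter_upwards [h.eventually (lt_mem_nhds hc), self_mem_nhdsWithin] with s hs hst
    rw [slope_def_field, hzero, sub_zero] at hs
    by_contra! hneg
    exact absurd hs (not_lt.2 (div_nonpos_of_nonneg_of_nonpos hneg (by linarith [hst.2])))
  obtain ⟨l, hl, hneg⟩ := (mem_nhdsLT_iff_exists_Ioo_subset' ht.1).1 hlt
  set m := max a l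
  have hm : m < t := max_lt ht.1 hl
  have hsub : Icc m t ⊆ Icc a b := Icc_subset_Icc (le_max_left _ _) ht.2
  have hanti : StrictAntiOn d (Icc m t) := by
    refine strictAntiOn_of_hasDerivWithinAt_neg (f' := d') (convex_Icc m t)
      (fun s hs => (hd s (hsub hs)).continuousWithinAt.mono hsub) ?_ ?_
    · intro s hs
      exact (hd s (hsub (interior_subset hs))).mono (interior_subset.trans hsub)
    · intro s hs
      rw [interior_Icc] at hs
      exact hneg ⟨(le_max_right _ _).trans_lt hs.1, hs.2⟩
  exact ⟨m, hsub (left_mem_Icc.2 hm.le), hanti (left_mem_Icc.2 hm.le) (right_mem_Icc.2 hm.le) hm⟩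

/-- Maximum principle with a Dirichlet condition on the left and a Neumann condition on the
right. -/
lemma nonpos_of_second_deriv_pos {a b : ℝ} {d d' : ℝ → ℝ}
    (hd : ∀ t ∈ Icc a b, HasDerivWithinAt d (d' t) (Icc a b) t)
    (ha : d a ≤ 0) (hb : d' b ≤ 0)
    (hpos : ∀ t ∈ Ioc a b, 0 < d t → d' t = 0 →
      ∃ c > 0, HasDerivWithinAt d' c (Icc a b) t) :
    ∀ t ∈ Icc a b, d t ≤ 0 := by
  intro t ht
  obtain ⟨m, hm, hmax⟩ := isCompact_Icc.exists_isMaxOn ⟨t, ht⟩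
    (fun s hs => (hd s hs).continuousWithinAt)
  refine (hmax ht).trans ?_
  by_contra! hdm
  have ham : a < m := lt_of_le_of_ne hm.1 (by rintro rfl; linarith)
  have hab : a ≤ b := hm.1.trans hm.2
  have hge : 0 ≤ d' m := by
    have := hmax.hasDerivWithinAt_mul_sub_nonpos (hd m hm) hm (left_mem_Icc.2 hab)
    nlinarith
  have hle : d' m ≤ 0 := by
    rcases hm.2.eq_or_lt with rfl | hmb
    · exact hb
    · have := hmax.hasDerivWithinAt_mul_sub_nonpos (hd m hm) hm (right_mem_Icc.2 hab)
      nlinarith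
  have hzero := le_antisymm hle hge
  obtain ⟨c, hc, hd'⟩ := hpos m ⟨ham, hm.2⟩ hdm hzero
  obtain ⟨s, hs, hlt⟩ :=
    exists_lt_of_deriv_eq_zero_of_second_deriv_pos hd ⟨ham, hm.2⟩ hzero hd' hc
  exact absurd (hmax hs) (not_le.2 hlt)

/-- Backward Grönwall-type bound from above. -/
lemma le_mul_exp_of_neg_le_deriv {a b K M : ℝ} {u u' : ℝ → ℝ} (hK : 0 ≤ K) (hM : 0 ≤ M)
    (hu : ∀ t ∈ Icc a b, HasDerivWithinAt u (u' t) (Icc a b) t) (hb : u b = 0)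
    (hbound : ∀ t ∈ Icc a b, -(K + M * |u t|) ≤ u' t) :
    ∀ t ∈ Icc a b, u t ≤ K * Real.exp ((M + 1) * (b - a)) := by
  intro t ht
  have hh : ∀ s ∈ Icc a b, HasDerivWithinAt (fun s => Real.exp ((M + 1) * (s - b)) * u s)
      (Real.exp ((M + 1) * (s - b)) * ((M + 1) * u s + u' s)) (Icc a b) s := by
    intro s hs
    have h1 : HasDerivAt (fun s => Real.exp ((M + 1) * (s - b)))
        (Real.exp ((M + 1) * (s - b)) * ((M + 1) * 1)) s :=
      (((hasDerivAt_id s).sub_const b).const_mul (M + 1)).exp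
    exact (h1.hasDerivWithinAt.mul (hu s hs)).congr_deriv (by ring)
  obtain ⟨m, hm, hmax⟩ := isCompact_Icc.exists_isMaxOn ⟨t, ht⟩
    (fun s hs => (hh s hs).continuousWithinAt)
  have hab : a ≤ b := hm.1.trans hm.2
  have hmK : Real.exp ((M + 1) * (m - b)) * u m ≤ K := by
    have he : Real.exp ((M + 1) * (m - b)) ≤ 1 :=
      Real.exp_le_one_iff.2 (mul_nonpos_of_nonneg_of_nonpos (by linarith) (by linarith [hm.2]))
    have he0 := Real.exp_pos ((M + 1) * (m - b))
    suffices u m ≤ K by nlinarith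
    by_contra! hlt
    have hmb : m < b := lt_of_le_of_ne hm.2 (by rintro rfl; linarith)
    have h1 := hmax.hasDerivWithinAt_mul_sub_nonpos (hh m hm) hm (right_mem_Icc.2 hab)
    have h2 := hbound m hm
    rw [abs_of_pos (hK.trans_lt hlt)] at h2
    have h3 : 0 < (M + 1) * u m + u' m := by linarith
    have := mul_pos (mul_pos he0 h3) (sub_pos.2 hmb)
    linarith
  have htK : Real.exp ((M + 1) * (t - b)) * u t ≤ K := (hmax ht).trans hmK
  calc u t = Real.exp ((M + 1) * (t - b)) * u t * Real.exp ((M + 1) * (b - t)) := by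
        rw [mul_right_comm, ← Real.exp_add]; simp [← mul_add]
    _ ≤ K * Real.exp ((M + 1) * (b - t)) := by gcongr
    _ ≤ K * Real.exp ((M + 1) * (b - a)) := by gcongr; exact ht.1

/-- Backward Grönwall-type bound. -/
lemma abs_le_mul_exp_of_abs_deriv_le {a b K M : ℝ} {u u' : ℝ → ℝ} (hK : 0 ≤ K) (hM : 0 ≤ M)
    (hu : ∀ t ∈ Icc a b, HasDerivWithinAt u (u' t) (Icc a b) t) (hb : u b = 0)
    (hbound : ∀ t ∈ Icc a b, |u' t| ≤ K + M * |u t|) :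
    ∀ t ∈ Icc a b, |u t| ≤ K * Real.exp ((M + 1) * (b - a)) := by
  intro t ht
  refine abs_le'.2 ⟨?_, ?_⟩
  · exact le_mul_exp_of_neg_le_deriv hK hM hu hb
      (fun s hs => (abs_le.1 (hbound s hs)).1) t ht
  · refine le_mul_exp_of_neg_le_deriv (u := fun s => -u s) (u' := fun s => -u' s) hK hM
      (fun s hs => (hu s hs).neg) (by simp [hb]) (fun s hs => ?_) t ht
    rw [abs_neg]
    linarith [(abs_le.1 (hbound s hs)).2]

/-- Shooting for a bounded, globally Lipschitz planar vector field. -/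
lemma exists_mixed_boundary_solution_of_bounded {a b : ℝ} (hab : a ≤ b)
    {G : ℝ → ℝ × ℝ → ℝ × ℝ} {C K : NNReal}
    (hlip : ∀ t ∈ Icc a b, LipschitzWith K (G t))
    (hcont : ∀ p, ContinuousOn (G · p) (Icc a b))
    (hC : ∀ t ∈ Icc a b, ∀ p, ‖G t p‖ ≤ C) :
    ∃ y : ℝ → ℝ × ℝ, (∀ t ∈ Icc a b, HasDerivWithinAt y (G t (y t)) (Icc a b) t) ∧
      (y a).1 = 0 ∧ (y b).2 = 0 := by
  set r : NNReal := C * ⟨b - a, sub_nonneg.2 hab⟩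
  have hrval : (r : ℝ) = C * (b - a) := NNReal.coe_mul _ _
  have hPL : IsPicardLindelof G (⟨a, left_mem_Icc.2 hab⟩ : Icc a b) 0 (r + r) r C K :=
    { lipschitzOnWith := fun t ht => (hlip t ht).lipschitzOnWith
      continuousOn := fun p _ => hcont p
      norm_le := fun t ht p _ => hC t ht p
      mul_max_le := by simp [hrval, hab] }
  obtain ⟨Φ, hΦ, hΦc⟩ := hPL.exists_forall_mem_closedBall_eq_hasDerivWithinAt_continuousOn
  have hball : ∀ s ∈ Icc (-r : ℝ) r, ((0, s) : ℝ × ℝ) ∈ Metric.closedBall (0 : ℝ × ℝ) r := by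
    intro s hs
    simpa [Prod.norm_def] using abs_le.2 hs
  have hclose : ∀ s ∈ Icc (-r : ℝ) r, |(Φ ((0, s), b)).2 - s| ≤ r := by
    intro s hs
    obtain ⟨hinit, hderiv⟩ := hΦ _ (hball s hs)
    have hbd := (convex_Icc a b).norm_image_sub_le_of_norm_hasDerivWithin_le hderiv
      (fun t ht => hC t ht _) (left_mem_Icc.2 hab) (right_mem_Icc.2 hab)
    have hsnd := (norm_snd_le _).trans hbd
    simp only [hinit] at hsnd
    simpa [Real.norm_eq_abs, abs_of_nonneg (sub_nonneg.2 hab), hrval] using hsnd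
  have hshoot : ContinuousOn (fun s : ℝ => (Φ ((0, s), b)).2) (Icc (-r : ℝ) r) := by
    refine continuous_snd.comp_continuousOn (hΦc.comp (by fun_prop) fun s hs => ?_)
    exact ⟨hball s hs, right_mem_Icc.2 hab⟩
  have hr0 : (-r : ℝ) ≤ r := by linarith [r.coe_nonneg]
  obtain ⟨s, hs, hs0⟩ := intermediate_value_Icc hr0 hshoot
    (show (0 : ℝ) ∈ Icc _ _ from
      ⟨by linarith [(abs_le.1 (hclose _ (left_mem_Icc.2 hr0))).2],
        by linarith [(abs_le.1 (hclose _ (right_mem_Icc.2 hr0))).1]⟩)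
  obtain ⟨hinit, hderiv⟩ := hΦ _ (hball s hs)
  exact ⟨fun t => Φ ((0, s), t), hderiv, by simpa using congrArg Prod.fst hinit, hs0⟩

/-- Truncation of a real number to `[-r, r]`. -/
def truncate (r x : ℝ) : ℝ := max (-r) (min r x)

lemma abs_truncate_le {r : ℝ} (hr : 0 ≤ r) (x : ℝ) : |truncate r x| ≤ r := by
  unfold truncate
  grind

lemma abs_truncate_le_abs {r : ℝ} (hr : 0 ≤ r) (x : ℝ) : |truncate r x| ≤ |x| := by
  unfold truncate
  grind

lemma truncate_of_abs_le {r x : ℝ} (h : |x| ≤ r) : truncate r x = x := by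
  unfold truncate
  grind

lemma truncate_neg {r : ℝ} (hr : 0 ≤ r) (x : ℝ) : truncate r (-x) = -truncate r x := by
  unfold truncate
  grind

lemma abs_truncate_sub_truncate_le (r x y : ℝ) :
    |truncate r x - truncate r y| ≤ |x - y| := by
  unfold truncate
  grind

lemma eq_of_truncate_eq {r x y : ℝ} (hy : |y| < r) (h : truncate r x = y) : x = y := by
  unfold truncate at h
  grind

lemma le_truncate {r x y : ℝ} (hy : y ≤ r) (h : y ≤ x) : y ≤ truncate r x :=
  le_max_of_le_right (le_min hy h)

/-- Upper barrier estimate for the truncated problem with homogeneous boundary conditions. -/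
lemma le_of_truncated_solution {a b M K A R S : ℝ} {g : ℝ → ℝ → ℝ → ℝ} {z u : ℝ → ℝ}
    (hM : 0 ≤ M) (hK : 0 ≤ K) (hA : K < A)
    (hR : A * Real.exp ((M + 1) * (b - a)) ≤ R) (hS : A * Real.exp ((M + 1) * (b - a)) < S)
    (hmono : ∀ t ∈ Icc a b, ∀ v, Monotone fun x => g t x v)
    (hlip : ∀ t ∈ Icc a b, ∀ x v w, |g t x v - g t x w| ≤ M * |v - w|)
    (hg0 : ∀ t ∈ Icc a b, |g t 0 0| ≤ K)
    (hz : ∀ t ∈ Icc a b, HasDerivWithinAt z (truncate S (u t)) (Icc a b) t)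
    (hu : ∀ t ∈ Icc a b,
      HasDerivWithinAt u (g t (truncate R (z t)) (truncate S (u t))) (Icc a b) t)
    (hza : z a = 0) (hub : u b = 0) :
    ∀ t ∈ Icc a b, z t ≤ R := by
  have hM1 : 0 < M + 1 := by linarith
  have hA0 : 0 < A := hK.trans_lt hA
  set p : ℝ → ℝ := fun t => A * Real.exp ((M + 1) * (b - t)) with hp
  set φ : ℝ → ℝ := fun t => (p a - p t) / (M + 1) with hφ
  have hp' : ∀ t, HasDerivAt p (-(M + 1) * p t) t := by
    intro t
    have h : HasDerivAt (fun s => Real.exp ((M + 1) * (b - s)))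
        (Real.exp ((M + 1) * (b - t)) * ((M + 1) * -1)) t :=
      (((hasDerivAt_id t).const_sub b).const_mul (M + 1)).exp
    exact (h.const_mul A).congr_deriv (by simp only [hp]; ring)
  have hφ' : ∀ t, HasDerivAt φ (p t) t := fun t =>
    (((hp' t).const_sub (p a)).div_const (M + 1)).congr_deriv (by field_simp)
  have hp0 : ∀ t, 0 < p t := fun t => mul_pos hA0 (Real.exp_pos _)
  have hpa : ∀ t ∈ Icc a b, p t ≤ p a := fun t ht => by
    simp only [hp]; gcongr; exact ht.1
  have hAp : ∀ t ∈ Icc a b, A ≤ p t := fun t ht =>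
    le_mul_of_one_le_right hA0.le
      (Real.one_le_exp (mul_nonneg hM1.le (sub_nonneg.2 ht.2)))
  have hφ0 : ∀ t ∈ Icc a b, 0 ≤ φ t := fun t ht =>
    div_nonneg (sub_nonneg.2 (hpa t ht)) hM1.le
  have hφR : ∀ t, φ t ≤ R := fun t => by
    refine le_trans ?_ hR
    change (p a - p t) / (M + 1) ≤ p a
    rw [div_le_iff₀ hM1]
    nlinarith [hp0 t, hp0 a]
  have hS0 : 0 ≤ S := (hp0 a).le.trans hS.le
  have key := nonpos_of_second_deriv_pos (d := fun t => z t - φ t)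
    (d' := fun t => truncate S (u t) - p t)
    (fun t ht => (hz t ht).sub (hφ' t).hasDerivWithinAt) (by simp [hza, hφ])
    (by
      rw [hub, truncate_of_abs_le (by simpa using hS0)]
      linarith [hp0 b])
    (fun t ht hpos hzero => by
      have htI : t ∈ Icc a b := Ioc_subset_Icc_self ht
      have hpS : |p t| < S := by
        rw [abs_of_pos (hp0 t)]
        exact (hpa t htI).trans_lt hS
      have hut : u t = p t := eq_of_truncate_eq hpS (sub_eq_zero.1 hzero)
      have heq : (fun s => truncate S (u s)) =ᶠ[nhdsWithin t (Icc a b)] u := by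
        have hcont : ContinuousWithinAt (fun s => |u s|) (Icc a b) t :=
          (hu t htI).continuousWithinAt.abs
        filter_upwards [hcont.eventually (gt_mem_nhds (hut ▸ hpS))] with s hs
        exact truncate_of_abs_le (le_of_lt hs)
      have htr : HasDerivWithinAt (fun s => truncate S (u s))
          (g t (truncate R (z t)) (truncate S (u t))) (Icc a b) t :=
        (hu t htI).congr_of_eventuallyEq heq (heq.eq_of_nhdsWithin htI)
      refine ⟨_, ?_, htr.sub (hp' t).hasDerivWithinAt⟩
      have h1 : g t 0 (p t) ≤ g t (truncate R (z t)) (p t) :=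
        hmono t htI _ (le_truncate ((hφ0 t htI).trans (hφR t))
          ((hφ0 t htI).trans (sub_pos.1 hpos).le))
      have h2 := (abs_le.1 (hlip t htI 0 (p t) 0)).1
      have h3 := (abs_le.1 (hg0 t htI)).1
      rw [sub_zero, abs_of_pos (hp0 t)] at h2
      rw [sub_eq_zero.1 hzero]
      linarith [hAp t htI])
  intro t ht
  linarith [key t ht, hφR t]

/-- Solvability of the problem with homogeneous boundary conditions `z a = 0`, `z' b = 0`. -/
lemma exists_homogeneous_mixed_boundary_solution {a b M : ℝ} (hab : a ≤ b) (hM : 0 ≤ M)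
    {g : ℝ → ℝ → ℝ → ℝ}
    (hcont : ContinuousOn (fun p : ℝ × ℝ × ℝ => g p.1 p.2.1 p.2.2)
      (Icc a b ×ˢ (univ : Set ℝ) ×ˢ (univ : Set ℝ)))
    (hmono : ∀ t ∈ Icc a b, ∀ v, Monotone fun x => g t x v)
    (hlip : ∀ t ∈ Icc a b, ∀ x v w, |g t x v - g t x w| ≤ M * |v - w|)
    (hloc : ∀ R S : ℝ, ∃ L : ℝ, ∀ t ∈ Icc a b, ∀ x y v, |x| ≤ R → |y| ≤ R → |v| ≤ S →
      |g t x v - g t y v| ≤ L * |x - y|) :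
    ∃ z u : ℝ → ℝ, (∀ t ∈ Icc a b, HasDerivWithinAt z (u t) (Icc a b) t) ∧
      (∀ t ∈ Icc a b, HasDerivWithinAt u (g t (z t) (u t)) (Icc a b) t) ∧
      z a = 0 ∧ u b = 0 := by
  have hbound : ∀ R S : ℝ, ∃ K ≥ 0, ∀ t ∈ Icc a b, ∀ x v, |x| ≤ R → |v| ≤ S →
      |g t x v| ≤ K := by
    intro R S
    obtain ⟨K, hK⟩ := ((isCompact_Icc (a := a) (b := b)).prod
      ((isCompact_Icc (a := -R) (b := R)).prod (isCompact_Icc (a := -S)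
        (b := S)))).exists_bound_of_continuousOn
      (hcont.mono (by gcongr <;> exact subset_univ _))
    exact ⟨max K 0, le_max_right _ _, fun t ht x v hx hv =>
      (hK (t, x, v) ⟨ht, abs_le.1 hx, abs_le.1 hv⟩).trans (le_max_left _ _)⟩
  obtain ⟨K, hK, hgK⟩ := hbound 0 0
  set E := Real.exp ((M + 1) * (b - a))
  have hE : 0 < E := Real.exp_pos _
  set R := (K + 1) * E
  have hR : 0 ≤ R := by positivity
  obtain ⟨K', hK', hgK'⟩ := hbound R 0
  set S := R + K' * E + 1
  have hRS : R < S := by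
    have : 0 ≤ K' * E := by positivity
    linarith
  have hS : 0 ≤ S := hR.trans hRS.le
  obtain ⟨B, hB, hgB⟩ := hbound R S
  obtain ⟨L, hL⟩ := hloc R S
  have hGlip : ∀ t ∈ Icc a b, LipschitzWith (1 + (|L| + M).toNNReal) fun q : ℝ × ℝ =>
      (truncate S q.2, g t (truncate R q.1) (truncate S q.2)) := by
    intro t ht
    refine LipschitzWith.of_dist_le_mul fun q q' => ?_
    have hcoe : ((1 + (|L| + M).toNNReal : NNReal) : ℝ) = 1 + (|L| + M) := by
      rw [NNReal.coe_add, Real.coe_toNNReal _ (by positivity), NNReal.coe_one]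
    have hfst : |q.1 - q'.1| ≤ dist q q' := le_max_left (dist q.1 q'.1) _
    have hsnd : |q.2 - q'.2| ≤ dist q q' := le_max_right _ (dist q.2 q'.2)
    have h1 := (abs_truncate_sub_truncate_le R q.1 q'.1).trans hfst
    have h2 := (abs_truncate_sub_truncate_le S q.2 q'.2).trans hsnd
    have h3 := hL t ht (truncate R q.1) (truncate R q'.1) (truncate S q.2)
      (abs_truncate_le hR _) (abs_truncate_le hR _) (abs_truncate_le hS _)
    have h4 := hlip t ht (truncate R q'.1) (truncate S q.2) (truncate S q'.2)
    have h5 := abs_sub_le (g t (truncate R q.1) (truncate S q.2))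
      (g t (truncate R q'.1) (truncate S q.2)) (g t (truncate R q'.1) (truncate S q'.2))
    have h6 : L * |truncate R q.1 - truncate R q'.1| ≤ |L| * dist q q' :=
      mul_le_mul (le_abs_self L) h1 (abs_nonneg _) (abs_nonneg L)
    have h7 : M * |truncate S q.2 - truncate S q'.2| ≤ M * dist q q' := by gcongr
    have h8 : 0 ≤ (|L| + M) * dist q q' := by positivity
    rw [hcoe]
    refine max_le ?_ ?_
    · rw [Real.dist_eq]
      linarith
    · rw [Real.dist_eq]
      linarith [dist_nonneg (x := q) (y := q')]
  have hGcont : ∀ q : ℝ × ℝ, ContinuousOn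
      (fun t => (truncate S q.2, g t (truncate R q.1) (truncate S q.2))) (Icc a b) := by
    intro q
    refine continuousOn_const.prodMk ?_
    exact hcont.comp (f := fun t => (t, truncate R q.1, truncate S q.2)) (by fun_prop)
      fun t ht => ⟨ht, mem_univ _, mem_univ _⟩
  have hGbound : ∀ t ∈ Icc a b, ∀ q : ℝ × ℝ,
      ‖(truncate S q.2, g t (truncate R q.1) (truncate S q.2))‖ ≤ ((S + B).toNNReal : ℝ) := by
    intro t ht q
    rw [Real.coe_toNNReal _ (by positivity)]
    refine max_le ?_ ?_
    · exact (abs_truncate_le hS _).trans (by linarith)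
    · exact (hgB t ht _ _ (abs_truncate_le hR _) (abs_truncate_le hS _)).trans (by linarith)
  obtain ⟨y, hy, hya, hyb⟩ :=
    exists_mixed_boundary_solution_of_bounded hab hGlip hGcont hGbound
  have hz : ∀ t ∈ Icc a b,
      HasDerivWithinAt (fun s => (y s).1) (truncate S (y t).2) (Icc a b) t :=
    fun t ht => (hy t ht).fst
  have hu : ∀ t ∈ Icc a b, HasDerivWithinAt (fun s => (y s).2)
      (g t (truncate R (y t).1) (truncate S (y t).2)) (Icc a b) t :=
    fun t ht => (hy t ht).snd
  have hzR : ∀ t ∈ Icc a b, |(y t).1| ≤ R := by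
    intro t ht
    refine abs_le'.2 ⟨?_, ?_⟩
    · exact le_of_truncated_solution hM hK (lt_add_one K) le_rfl hRS hmono hlip
        (fun s hs => hgK s hs 0 0 (by simp) (by simp)) hz hu hya hyb t ht
    · refine le_of_truncated_solution (g := fun s x v => -g s (-x) (-v))
        (R := R) (z := fun s => -(y s).1) (u := fun s => -(y s).2)
        hM hK (lt_add_one K) le_rfl hRS ?_ ?_ ?_ ?_ ?_ (by simp [hya]) (by simp [hyb]) t ht
      · exact fun s hs v x x' hx => neg_le_neg (hmono s hs (-v) (neg_le_neg hx))
      · intro s hs x v w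
        simpa only [neg_sub_neg] using hlip s hs (-x) (-w) (-v)
      · intro s hs
        simpa using hgK s hs 0 0 (by simp) (by simp)
      · intro s hs
        exact (hz s hs).neg.congr_deriv (truncate_neg hS _).symm
      · intro s hs
        exact (hu s hs).neg.congr_deriv (by simp only [truncate_neg hS, truncate_neg hR, neg_neg])
  have huS : ∀ t ∈ Icc a b, |(y t).2| ≤ S := by
    intro t ht
    refine (abs_le_mul_exp_of_abs_deriv_le hK' hM hu hyb (fun s hs => ?_) t ht).trans
      (by linarith)
    have h1 := hgK' s hs (truncate R (y s).1) 0 (abs_truncate_le hR _) (by simp)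
    have h2 := hlip s hs (truncate R (y s).1) (truncate S (y s).2) 0
    have h3 := abs_sub_abs_le_abs_sub (g s (truncate R (y s).1) (truncate S (y s).2))
      (g s (truncate R (y s).1) 0)
    have h4 : M * |truncate S (y s).2 - 0| ≤ M * |(y s).2| := by
      rw [sub_zero]
      exact mul_le_mul_of_nonneg_left (abs_truncate_le_abs hS _) hM
    linarith
  refine ⟨fun t => (y t).1, fun t => (y t).2, fun t ht => ?_, fun t ht => ?_, hya, hyb⟩
  · simpa [truncate_of_abs_le (huS t ht)] using hz t ht
  · simpa [truncate_of_abs_le (huS t ht), truncate_of_abs_le (hzR t ht)] using hu t ht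

/-- Solutions with the same data are ordered both ways when `f` is increasing in the state. -/
lemma IsMixedBVPSolution.le {a b α β : ℝ} {f : ℝ → ℝ → ℝ → ℝ} {x y : ℝ → ℝ} (hab : a < b)
    (hmono : ∀ t ∈ Icc a b, ∀ v, StrictMono fun x => f t x v)
    (hx : IsMixedBVPSolution a b α β f x) (hy : IsMixedBVPSolution a b α β f y) :
    ∀ t ∈ Icc a b, x t ≤ y t := by
  have hderiv : ∀ w, IsMixedBVPSolution a b α β f w → ∀ t ∈ Icc a b,
      HasDerivWithinAt w (derivWithin w (Icc a b) t) (Icc a b) t ∧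
      HasDerivWithinAt (derivWithin w (Icc a b)) (f t (w t) (derivWithin w (Icc a b) t))
        (Icc a b) t := by
    intro w hw t ht
    have h1 : ContDiffOn ℝ 1 (derivWithin w (Icc a b)) (Icc a b) :=
      hw.1.derivWithin (uniqueDiffOn_Icc hab) (by norm_num)
    refine ⟨(hw.1.differentiableOn (by norm_num) t ht).hasDerivWithinAt, ?_⟩
    rw [← hw.2.1 t ht]
    exact (h1.differentiableOn (by norm_num) t ht).hasDerivWithinAt
  have key := nonpos_of_second_deriv_pos
    (fun t ht => (hderiv x hx t ht).1.sub (hderiv y hy t ht).1)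
    (by simp [hx.2.2.1, hy.2.2.1]) (by simp [hx.2.2.2, hy.2.2.2])
    (fun t ht hpos hzero => by
      have htI := Ioc_subset_Icc_self ht
      refine ⟨_, ?_, (hderiv x hx t htI).2.sub (hderiv y hy t htI).2⟩
      rw [sub_eq_zero.1 hzero]
      exact sub_pos.2 (hmono t htI _ (sub_pos.1 hpos)))
  exact fun t ht => sub_nonpos.1 (key t ht)

/-- A solution of the first-order system gives a solution of the boundary value problem. -/
lemma isMixedBVPSolution_of_hasDerivWithinAt {a b α β : ℝ} {f : ℝ → ℝ → ℝ → ℝ} {x v : ℝ → ℝ}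
    (hab : a < b)
    (hf : ContinuousOn (fun p : ℝ × ℝ × ℝ => f p.1 p.2.1 p.2.2)
      (Icc a b ×ˢ (univ : Set ℝ) ×ˢ (univ : Set ℝ)))
    (hx : ∀ t ∈ Icc a b, HasDerivWithinAt x (v t) (Icc a b) t)
    (hv : ∀ t ∈ Icc a b, HasDerivWithinAt v (f t (x t) (v t)) (Icc a b) t)
    (ha : x a = α) (hb : v b = β) : IsMixedBVPSolution a b α β f x := by
  have hunique := uniqueDiffOn_Icc hab
  have hx' : ∀ t ∈ Icc a b, derivWithin x (Icc a b) t = v t := fun t ht =>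
    (hx t ht).derivWithin (hunique t ht)
  have hv' : ∀ t ∈ Icc a b, derivWithin v (Icc a b) t = f t (x t) (v t) := fun t ht =>
    (hv t ht).derivWithin (hunique t ht)
  have hcont : ContinuousOn (fun t => f t (x t) (v t)) (Icc a b) :=
    hf.comp (f := fun t => (t, x t, v t))
      (continuousOn_id.prodMk ((HasDerivWithinAt.continuousOn hx).prodMk
        (HasDerivWithinAt.continuousOn hv)))
      fun t ht => ⟨ht, mem_univ _, mem_univ _⟩
  have hv1 : ContDiffOn ℝ 1 v (Icc a b) := by
    rw [show (1 : WithTop ℕ∞) = 0 + 1 by norm_num, contDiffOn_succ_iff_derivWithin hunique]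
    refine ⟨fun t ht => (hv t ht).differentiableWithinAt, by simp, ?_⟩
    exact contDiffOn_zero.2 (hcont.congr hv')
  refine ⟨?_, fun t ht => ?_, ha, (hx' b (right_mem_Icc.2 hab.le)).trans hb⟩
  · rw [show (2 : WithTop ℕ∞) = 1 + 1 by norm_num, contDiffOn_succ_iff_derivWithin hunique]
    exact ⟨fun t ht => (hx t ht).differentiableWithinAt, by simp, hv1.congr hx'⟩
  · rw [derivWithin_congr hx' (hx' t ht), hv' t ht, hx' t ht]

/-- Theorem 3.1 of the paper: if `f` is continuous on `D = [a,b] × ℝ × ℝ` with continuous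
partial derivatives `f_x` and `f_{x'}` there, `f_x > 0` on `D`, and `|f_{x'}| ≤ M` on `D`
for some `M > 0`, then for any `α, β` the boundary value problem
`x'' = f(t, x, x')`, `x(a) = α`, `x'(b) = β` has a unique solution. -/
theorem mixed_bvp_existence_uniqueness (a b : ℝ) (hab : a < b)
    (f fx fx' : ℝ → ℝ → ℝ → ℝ)
    (hf_cont : ContinuousOn (fun p : ℝ × ℝ × ℝ => f p.1 p.2.1 p.2.2)
      (Icc a b ×ˢ (univ : Set ℝ) ×ˢ (univ : Set ℝ)))
    (hfx_cont : ContinuousOn (fun p : ℝ × ℝ × ℝ => fx p.1 p.2.1 p.2.2)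
      (Icc a b ×ˢ (univ : Set ℝ) ×ˢ (univ : Set ℝ)))
    (hfx'_cont : ContinuousOn (fun p : ℝ × ℝ × ℝ => fx' p.1 p.2.1 p.2.2)
      (Icc a b ×ˢ (univ : Set ℝ) ×ˢ (univ : Set ℝ)))
    (hfx_deriv : ∀ t ∈ Icc a b, ∀ x v : ℝ, HasDerivAt (fun u => f t u v) (fx t x v) x)
    (hfx'_deriv : ∀ t ∈ Icc a b, ∀ x v : ℝ, HasDerivAt (fun w => f t x w) (fx' t x v) v)
    (hpos : ∀ t ∈ Icc a b, ∀ x v : ℝ, 0 < fx t x v)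
    (hbdd : ∃ M > 0, ∀ t ∈ Icc a b, ∀ x v : ℝ, |fx' t x v| ≤ M)
    (α β : ℝ) :
    (∃ x : ℝ → ℝ, IsMixedBVPSolution a b α β f x) ∧
      ∀ x y : ℝ → ℝ, IsMixedBVPSolution a b α β f x →
        IsMixedBVPSolution a b α β f y → EqOn x y (Icc a b) := by
  obtain ⟨M, hM, hfx'⟩ := hbdd
  have hmono : ∀ t ∈ Icc a b, ∀ v, StrictMono fun x => f t x v := fun t ht v =>
    strictMono_of_hasDerivAt_pos (fun x => hfx_deriv t ht x v) (fun x => hpos t ht x v)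
  refine ⟨?_, fun x y hx hy t ht => le_antisymm (hx.le hab hmono hy t ht) (hy.le hab hmono hx t ht)⟩
  have hlip : ∀ t ∈ Icc a b, ∀ x v w, |f t x v - f t x w| ≤ M * |v - w| := fun t ht x v w =>
    convex_univ.norm_image_sub_le_of_norm_hasDerivWithin_le
      (fun s _ => (hfx'_deriv t ht x s).hasDerivWithinAt) (fun s _ => hfx' t ht x s)
      (mem_univ w) (mem_univ v)
  set w : ℝ → ℝ := fun t => α + β * (t - a) with hw
  have hwc : Continuous w := by fun_prop
  have hw' : ∀ t, HasDerivAt w β t := fun t =>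
    ((((hasDerivAt_id t).sub_const a).const_mul β).const_add α).congr_deriv (mul_one β)
  have hloc : ∀ R S : ℝ, ∃ L : ℝ, ∀ t ∈ Icc a b, ∀ x y v, |x| ≤ R → |y| ≤ R → |v| ≤ S →
      |f t (w t + x) (β + v) - f t (w t + y) (β + v)| ≤ L * |x - y| := by
    intro R S
    have hcont : ContinuousOn (fun p : ℝ × ℝ × ℝ => fx p.1 (w p.1 + p.2.1) (β + p.2.2))
        (Icc a b ×ˢ Icc (-R) R ×ˢ Icc (-S) S) :=
      hfx_cont.comp (f := fun p : ℝ × ℝ × ℝ => (p.1, w p.1 + p.2.1, β + p.2.2))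
        (by fun_prop) fun p hp => ⟨hp.1, mem_univ _, mem_univ _⟩
    obtain ⟨L, hL⟩ := (isCompact_Icc.prod
      (isCompact_Icc.prod isCompact_Icc)).exists_bound_of_continuousOn hcont
    refine ⟨L, fun t ht x y v hx hy hv => ?_⟩
    exact (convex_Icc (-R) R).norm_image_sub_le_of_norm_hasDerivWithin_le
      (f := fun s => f t (w t + s) (β + v))
      (fun s _ => ((hfx_deriv t ht (w t + s) (β + v)).comp_const_add (w t) s).hasDerivWithinAt)
      (fun s hs => hL (t, s, v) ⟨ht, hs, abs_le.1 hv⟩) (abs_le.1 hy) (abs_le.1 hx)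
  obtain ⟨z, u, hz, hu, hza, hub⟩ := exists_homogeneous_mixed_boundary_solution hab.le hM.le
    (g := fun t x v => f t (w t + x) (β + v))
    (hf_cont.comp (f := fun p : ℝ × ℝ × ℝ => (p.1, w p.1 + p.2.1, β + p.2.2))
      (by fun_prop) fun p hp => ⟨hp.1, mem_univ _, mem_univ _⟩)
    (fun t ht v x y hxy => (hmono t ht (β + v)).monotone (by gcongr))
    (fun t ht x v v' => by simpa using hlip t ht (w t + x) (β + v) (β + v'))
    hloc
  exact ⟨fun t => w t + z t, isMixedBVPSolution_of_hasDerivWithinAt hab hf_cont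
    (fun t ht => (hw' t).hasDerivWithinAt.add (hz t ht)) (fun t ht => (hu t ht).const_add β)
    (by simp [hw, hza]) (by simp [hub])⟩
end

section
/- There exists a unique function x : [1,2] → ℝ, twice continuously differentiable on [1,2], satisfying x''(t) + sin(x'(t)) + e^{−t·x(t)} = 0 for all t ∈ [1,2] together with the boundary conditions x(1) = 0 and x(2) = 0. -/
open Set

/-- `x` is a solution of the boundary value problem
`x'' + sin(x') + e^{−t·x} = 0` on `[1,2]`, `x(1) = 0`, `x(2) = 0`,
with `x` twice continuously differentiable on `[1,2]`
(derivatives taken within `[1,2]`). -/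
def IsExampleBVPSolution (x : ℝ → ℝ) : Prop :=
  ContDiffOn ℝ 2 x (Icc (1 : ℝ) 2) ∧
  (∀ t ∈ Icc (1 : ℝ) 2,
    derivWithin (derivWithin x (Icc (1 : ℝ) 2)) (Icc (1 : ℝ) 2) t +
      Real.sin (derivWithin x (Icc (1 : ℝ) 2) t) + Real.exp (-t * x t) = 0) ∧
  x 1 = 0 ∧ x 2 = 0

open scoped BoundedContinuousFunction

/-- Weak maximum principle: a function which is nonpositive at both ends of an interval and strictly
convex at each of its interior positive critical points is nonpositive. -/
lemma nonpos_of_deriv_deriv_pos_of_pos {d : ℝ → ℝ} {a b : ℝ} (hab : a ≤ b)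
    (hd : ContinuousOn d (Icc a b)) (ha : d a ≤ 0) (hb : d b ≤ 0)
    (h : ∀ t ∈ Ioo a b, 0 < d t → deriv d t = 0 → 0 < deriv (deriv d) t) :
    ∀ t ∈ Icc a b, d t ≤ 0 := by
  obtain ⟨m, hm, hmax⟩ := isCompact_Icc.exists_isMaxOn (nonempty_Icc.2 hab) hd
  suffices hdm : d m ≤ 0 from fun t ht => (hmax ht).trans hdm
  by_contra! hpos
  have hmI : m ∈ Ioo a b := by
    refine ⟨lt_of_le_of_ne hm.1 ?_, lt_of_le_of_ne hm.2 ?_⟩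
    · rintro rfl; linarith
    · rintro rfl; linarith
  have hnhds : Icc a b ∈ nhds m := Icc_mem_nhds hmI.1 hmI.2
  have hlmax : IsLocalMax d m := hmax.isLocalMax hnhds
  have hderiv : deriv d m = 0 := hlmax.deriv_eq_zero
  have hderiv2 := h m hmI hpos hderiv
  have hlmin : IsLocalMin d m :=
    isLocalMin_of_deriv_deriv_pos hderiv2 hderiv (hd.continuousAt hnhds)
  have hconst : d =ᶠ[nhds m] fun _ => d m := by
    filter_upwards [hlmax, hlmin] with t h₁ h₂ using le_antisymm h₁ h₂
  rw [hconst.deriv.deriv_eq] at hderiv2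
  simp at hderiv2

/-- Second-order Taylor estimate to the right of the base point. -/
lemma abs_taylor_two_le_of_le {X X' u : ℝ → ℝ} {M : ℝ} (hX : ∀ t, HasDerivAt X (X' t) t)
    (hX' : ∀ t, HasDerivAt X' (u t) t) (hu : ∀ t, |u t| ≤ M) {a b : ℝ} (hab : a ≤ b) :
    |X b - X a - X' a * (b - a)| ≤ M * (b - a) ^ 2 / 2 := by
  have hLip : ∀ s, |X' s - X' a| ≤ M * |s - a| := fun s =>
    convex_univ.norm_image_sub_le_of_norm_hasDerivWithin_le
      (fun t _ => (hX' t).hasDerivWithinAt) (fun t _ => hu t) (mem_univ a) (mem_univ s)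
  have hφ : ∀ s, HasDerivAt (fun s => X s - X a - X' a * (s - a)) (X' s - X' a) s := fun s => by
    simpa using! ((hX s).sub_const (X a)).sub (((hasDerivAt_id s).sub_const a).const_mul (X' a))
  have hB : ∀ s, HasDerivAt (fun s => M * (s - a) ^ 2 / 2) (M * (s - a)) s := fun s => by
    have := ((((hasDerivAt_id s).sub_const a).pow 2).const_mul M).div_const 2
    refine this.congr_deriv ?_
    simp; ring
  refine image_norm_le_of_norm_deriv_right_le_deriv_boundary
    (f := fun s => X s - X a - X' a * (s - a)) (f' := fun s => X' s - X' a)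
    (fun s _ => (hφ s).continuousAt.continuousWithinAt)
    (fun s _ => (hφ s).hasDerivWithinAt) (by simp) hB (fun s hs => ?_) (right_mem_Icc.2 hab)
  have := hLip s
  rwa [abs_of_nonneg (sub_nonneg.2 hs.1)] at this

/-- Second-order Taylor estimate. -/
lemma abs_taylor_two_le {X X' u : ℝ → ℝ} {M : ℝ} (hX : ∀ t, HasDerivAt X (X' t) t)
    (hX' : ∀ t, HasDerivAt X' (u t) t) (hu : ∀ t, |u t| ≤ M) (a b : ℝ) :
    |X b - X a - X' a * (b - a)| ≤ M * (b - a) ^ 2 / 2 := by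
  rcases le_total a b with hab | hab
  · exact abs_taylor_two_le_of_le hX hX' hu hab
  · have h₁ : ∀ t, HasDerivAt (fun t => X (-t)) (-X' (-t)) t := fun t => by
      simpa using! (hX (-t)).comp t (hasDerivAt_neg t)
    have h₂ : ∀ t, HasDerivAt (fun t => -X' (-t)) (u (-t)) t := fun t => by
      simpa using! ((hX' (-t)).comp t (hasDerivAt_neg t)).neg
    have := abs_taylor_two_le_of_le h₁ h₂ (fun t => hu (-t)) (neg_le_neg hab)
    simp only [neg_neg] at this
    convert this using 2 <;> ring

/-- Bounds on a function vanishing at `1` and `2`, and on its derivative, in terms of a bound on the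
second derivative. -/
lemma dirichlet_bounds {X X' u : ℝ → ℝ} {M : ℝ} (hX : ∀ t, HasDerivAt X (X' t) t)
    (hX' : ∀ t, HasDerivAt X' (u t) t) (hu : ∀ t, |u t| ≤ M) (h1 : X 1 = 0) (h2 : X 2 = 0)
    {t : ℝ} (ht : t ∈ Icc (1 : ℝ) 2) : |X t| ≤ M / 8 ∧ |X' t| ≤ M / 2 := by
  have hM : 0 ≤ M := (abs_nonneg _).trans (hu 0)
  obtain ⟨ht1, ht2⟩ := ht
  have hl := abs_le.1 (abs_taylor_two_le hX hX' hu t 1)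
  have hr := abs_le.1 (abs_taylor_two_le hX hX' hu t 2)
  rw [h1] at hl
  rw [h2] at hr
  have hq : 0 ≤ M * ((t - 1) * (2 - t)) :=
    mul_nonneg hM (mul_nonneg (sub_nonneg.2 ht1) (sub_nonneg.2 ht2))
  have hs : 0 ≤ M * (2 * t - 3) ^ 2 := by positivity
  have l1 := mul_le_mul_of_nonneg_left hl.1 (sub_nonneg.2 ht2)
  have l2 := mul_le_mul_of_nonneg_left hl.2 (sub_nonneg.2 ht2)
  have r1 := mul_le_mul_of_nonneg_left hr.1 (sub_nonneg.2 ht1)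
  have r2 := mul_le_mul_of_nonneg_left hr.2 (sub_nonneg.2 ht1)
  refine ⟨abs_le.2 ⟨?_, ?_⟩, abs_le.2 ⟨?_, ?_⟩⟩
  · linarith
  · linarith
  · linarith
  · linarith

/-- The derivative of `dirichletSol v`. -/
noncomputable def dirichletSolDeriv (v : ℝ → ℝ) (t : ℝ) : ℝ :=
  (∫ s in (1 : ℝ)..t, v s) - ∫ r in (1 : ℝ)..2, ∫ s in (1 : ℝ)..r, v s

/-- The solution of `x'' = v`, `x 1 = x 2 = 0`. -/
noncomputable def dirichletSol (v : ℝ → ℝ) (t : ℝ) : ℝ :=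
  ∫ s in (1 : ℝ)..t, dirichletSolDeriv v s

lemma hasDerivAt_dirichletSolDeriv {v : ℝ → ℝ} (hv : Continuous v) (t : ℝ) :
    HasDerivAt (dirichletSolDeriv v) (v t) t :=
  (hv.integral_hasStrictDerivAt 1 t).hasDerivAt.sub_const _

lemma continuous_dirichletSolDeriv {v : ℝ → ℝ} (hv : Continuous v) :
    Continuous (dirichletSolDeriv v) :=
  continuous_iff_continuousAt.2 fun t => (hasDerivAt_dirichletSolDeriv hv t).continuousAt

lemma hasDerivAt_dirichletSol {v : ℝ → ℝ} (hv : Continuous v) (t : ℝ) :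
    HasDerivAt (dirichletSol v) (dirichletSolDeriv v t) t :=
  ((continuous_dirichletSolDeriv hv).integral_hasStrictDerivAt 1 t).hasDerivAt

lemma continuous_dirichletSol {v : ℝ → ℝ} (hv : Continuous v) : Continuous (dirichletSol v) :=
  continuous_iff_continuousAt.2 fun t => (hasDerivAt_dirichletSol hv t).continuousAt

lemma dirichletSol_one (v : ℝ → ℝ) : dirichletSol v 1 = 0 := by simp [dirichletSol]

lemma dirichletSol_two {v : ℝ → ℝ} (hv : Continuous v) : dirichletSol v 2 = 0 := by
  have hc : Continuous fun r => ∫ s in (1 : ℝ)..r, v s :=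
    intervalIntegral.continuous_primitive (fun a b => hv.intervalIntegrable a b) 1
  simp only [dirichletSol, dirichletSolDeriv]
  rw [intervalIntegral.integral_sub (hc.intervalIntegrable 1 2) (by simp)]
  norm_num

/-- The right-hand side of the equation, with `x` truncated below at `0`. -/
noncomputable def truncatedRhs (t x p : ℝ) : ℝ := -Real.sin p - Real.exp (-t * max x 0)

lemma abs_exp_neg_sub_exp_neg_le {a b : ℝ} (ha : 0 ≤ a) (hb : 0 ≤ b) :
    |Real.exp (-a) - Real.exp (-b)| ≤ |a - b| := by
  have key : ∀ {a b : ℝ}, 0 ≤ a → a ≤ b →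
      |Real.exp (-a) - Real.exp (-b)| ≤ |a - b| := fun {a b} ha hab => by
    have h1 : Real.exp (-b) ≤ Real.exp (-a) := Real.exp_le_exp.2 (by linarith)
    have h2 : Real.exp (-a) ≤ 1 := Real.exp_le_one_iff.2 (by linarith)
    have h3 : Real.exp (-b) = Real.exp (-a) * Real.exp (a - b) := by
      rw [← Real.exp_add]; ring_nf
    have h4 := Real.add_one_le_exp (a - b)
    rw [abs_of_nonneg (by linarith), abs_of_nonpos (by linarith)]
    nlinarith [Real.exp_pos (-a)]
  rcases le_total a b with hab | hab
  · exact key ha hab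
  · rw [abs_sub_comm, abs_sub_comm a b]
    exact key hb hab

lemma abs_truncatedRhs_sub_le {t : ℝ} (ht : t ∈ Icc (1 : ℝ) 2) (x y p q : ℝ) :
    |truncatedRhs t x p - truncatedRhs t y q| ≤ 2 * |x - y| + |p - q| := by
  have ht0 : 0 ≤ t := zero_le_one.trans ht.1
  have hsin : |Real.sin p - Real.sin q| ≤ |p - q| := Real.abs_sin_sub_sin_le p q
  have hexp := abs_exp_neg_sub_exp_neg_le (mul_nonneg ht0 (le_max_right x 0))
    (mul_nonneg ht0 (le_max_right y 0))
  have hmax : |max x 0 - max y 0| ≤ |x - y| := abs_max_sub_max_le_abs x y 0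
  rw [← mul_sub, abs_mul, abs_of_nonneg ht0] at hexp
  have hmul : t * |max x 0 - max y 0| ≤ 2 * |x - y| :=
    mul_le_mul ht.2 hmax (abs_nonneg _) zero_le_two
  have hsplit : truncatedRhs t x p - truncatedRhs t y q =
      -(Real.sin p - Real.sin q) - (Real.exp (-(t * max x 0)) - Real.exp (-(t * max y 0))) := by
    simp only [truncatedRhs, neg_mul]; ring
  rw [hsplit]
  refine (norm_sub_le (E := ℝ) _ _).trans ?_
  simp only [Real.norm_eq_abs, abs_neg]
  linarith

lemma abs_truncatedRhs_le {t : ℝ} (ht : t ∈ Icc (1 : ℝ) 2) (x p : ℝ) :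
    |truncatedRhs t x p| ≤ 2 := by
  have h0 : 0 ≤ t * max x 0 := mul_nonneg (zero_le_one.trans ht.1) (le_max_right x 0)
  have h1 : Real.exp (-t * max x 0) ≤ 1 := Real.exp_le_one_iff.2 (by linarith)
  have h2 := Real.exp_pos (-t * max x 0)
  rw [truncatedRhs, abs_le]
  constructor <;> linarith [Real.neg_one_le_sin p, Real.sin_le_one p]

/-- The map sending a candidate `v` for the second derivative to the right-hand side of the truncated
equation along the solution of `x'' = v`, `x 1 = x 2 = 0`. -/
noncomputable def bvpMap (v : ℝ →ᵇ ℝ) : ℝ →ᵇ ℝ :=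
  BoundedContinuousFunction.ofNormedAddCommGroup
    (fun t => truncatedRhs (projIcc (1 : ℝ) 2 one_le_two t)
      (dirichletSol v (projIcc (1 : ℝ) 2 one_le_two t))
      (dirichletSolDeriv v (projIcc (1 : ℝ) 2 one_le_two t)))
    (by
      have h1 := continuous_dirichletSol v.continuous
      have h2 := continuous_dirichletSolDeriv v.continuous
      have h3 : Continuous fun t : ℝ => (projIcc (1 : ℝ) 2 one_le_two t : ℝ) :=
        continuous_subtype_val.comp continuous_projIcc
      unfold truncatedRhs
      fun_prop)
    2 (fun t => abs_truncatedRhs_le (projIcc (1 : ℝ) 2 one_le_two t).2 _ _)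

lemma contractingWith_bvpMap : ContractingWith (3 / 4) bvpMap := by
  refine ⟨by rw [← NNReal.coe_lt_coe]; norm_num, LipschitzWith.of_dist_le_mul fun v w => ?_⟩
  refine (BoundedContinuousFunction.dist_le (by positivity)).2 fun t => ?_
  obtain ⟨hb, hb'⟩ := dirichlet_bounds (M := dist v w) (u := fun t => v t - w t)
    (fun t => (hasDerivAt_dirichletSol v.continuous t).sub
      (hasDerivAt_dirichletSol w.continuous t))
    (fun t => (hasDerivAt_dirichletSolDeriv v.continuous t).sub
      (hasDerivAt_dirichletSolDeriv w.continuous t))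
    (fun t => BoundedContinuousFunction.dist_coe_le_dist (f := v) (g := w) t)
    (by simp [dirichletSol_one])
    (by simp [dirichletSol_two v.continuous, dirichletSol_two w.continuous])
    (projIcc (1 : ℝ) 2 one_le_two t).2
  refine (abs_truncatedRhs_sub_le (projIcc (1 : ℝ) 2 one_le_two t).2 _ _ _ _).trans ?_
  simp only [Pi.sub_apply] at hb hb'
  simp only [NNReal.coe_div, NNReal.coe_ofNat]
  linarith

lemma exists_truncated_solution : ∃ x p v : ℝ → ℝ, Continuous v ∧
    (∀ t, HasDerivAt x (p t) t) ∧ (∀ t, HasDerivAt p (v t) t) ∧ x 1 = 0 ∧ x 2 = 0 ∧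
    ∀ t ∈ Icc (1 : ℝ) 2, v t = truncatedRhs t (x t) (p t) := by
  obtain ⟨v, hv, -⟩ := contractingWith_bvpMap.exists_fixedPoint 0 (edist_ne_top _ _)
  refine ⟨dirichletSol v, dirichletSolDeriv v, v, v.continuous,
    hasDerivAt_dirichletSol v.continuous, hasDerivAt_dirichletSolDeriv v.continuous,
    dirichletSol_one v, dirichletSol_two v.continuous, fun t ht => ?_⟩
  have h : bvpMap v t = v t := by rw [hv]
  rw [← h]
  simp [bvpMap, projIcc_of_mem one_le_two ht]

lemma exists_isExampleBVPSolution : ∃ x : ℝ → ℝ, IsExampleBVPSolution x := by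
  obtain ⟨x, p, v, hv, hx, hp, h1, h2, heq⟩ := exists_truncated_solution
  have hdx : deriv x = p := funext fun t => (hx t).deriv
  have hdp : deriv p = v := funext fun t => (hp t).deriv
  have hnonneg : ∀ t ∈ Icc (1 : ℝ) 2, -x t ≤ 0 := by
    refine nonpos_of_deriv_deriv_pos_of_pos (d := fun t => -x t) one_le_two
      (fun t _ => (hx t).neg.continuousAt.continuousWithinAt) (by simp [h1]) (by simp [h2])
      fun t ht hpos hcrit => ?_
    have hd : deriv (fun t => -x t) = fun t => -p t := funext fun t => (hx t).neg.deriv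
    rw [hd] at hcrit ⊢
    have hd' : deriv (fun t => -p t) t = -v t := (hp t).neg.deriv
    have hpt : p t = 0 := neg_eq_zero.1 hcrit
    rw [hd', heq t (Ioo_subset_Icc_self ht), hpt, truncatedRhs]
    simpa using Real.exp_pos _
  have hdw : ∀ t ∈ Icc (1 : ℝ) 2, derivWithin x (Icc 1 2) t = p t := fun t ht =>
    (hx t).hasDerivWithinAt.derivWithin (uniqueDiffOn_Icc one_lt_two t ht)
  refine ⟨x, ContDiff.contDiffOn ?_, fun t ht => ?_, h1, h2⟩
  · have hp1 : ContDiff ℝ 1 p :=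
      contDiff_one_iff_deriv.2 ⟨fun t => (hp t).differentiableAt, hdp ▸ hv⟩
    rw [show (2 : WithTop ℕ∞) = 1 + 1 from (one_add_one_eq_two).symm, contDiff_succ_iff_deriv]
    exact ⟨fun t => (hx t).differentiableAt, by simp, hdx ▸ hp1⟩
  · rw [derivWithin_congr hdw (hdw t ht), hdw t ht,
      (hp t).hasDerivWithinAt.derivWithin (uniqueDiffOn_Icc one_lt_two t ht), heq t ht,
      truncatedRhs, max_eq_left (by linarith [hnonneg t ht])]
    ring

/-- On the open interval, derivatives within `[1,2]` are ordinary derivatives. -/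
lemma IsExampleBVPSolution.interior {x : ℝ → ℝ} (hx : IsExampleBVPSolution x) {t : ℝ}
    (ht : t ∈ Ioo (1 : ℝ) 2) :
    DifferentiableAt ℝ x t ∧ DifferentiableAt ℝ (deriv x) t ∧
      deriv (deriv x) t = -Real.sin (deriv x t) - Real.exp (-t * x t) := by
  obtain ⟨hC, heq, -, -⟩ := hx
  have hnhds : Icc (1 : ℝ) 2 ∈ nhds t := Icc_mem_nhds ht.1 ht.2
  have hCt : ContDiffAt ℝ 2 x t := hC.contDiffAt hnhds
  have hev : derivWithin x (Icc (1 : ℝ) 2) =ᶠ[nhds t] deriv x := by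
    filter_upwards [Ioo_mem_nhds ht.1 ht.2] with s hs
    exact derivWithin_of_mem_nhds (Icc_mem_nhds hs.1 hs.2)
  refine ⟨hCt.differentiableAt (by simp), ?_, ?_⟩
  · exact (hCt.derivWithin (m := 1) (by norm_num)).differentiableAt (by simp)
  · have h := heq t (Ioo_subset_Icc_self ht)
    rw [derivWithin_of_mem_nhds hnhds, hev.deriv_eq, hev.eq_of_nhds] at h
    linarith

lemma IsExampleBVPSolution.le {x y : ℝ → ℝ} (hx : IsExampleBVPSolution x)
    (hy : IsExampleBVPSolution y) : ∀ t ∈ Icc (1 : ℝ) 2, x t ≤ y t := by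
  suffices h : ∀ t ∈ Icc (1 : ℝ) 2, x t - y t ≤ 0 from fun t ht => sub_nonpos.1 (h t ht)
  refine nonpos_of_deriv_deriv_pos_of_pos (d := fun t => x t - y t) one_le_two
    (hx.1.continuousOn.sub hy.1.continuousOn) (by simp [hx.2.2.1, hy.2.2.1])
    (by simp [hx.2.2.2, hy.2.2.2]) fun t ht hpos hcrit => ?_
  have hev : deriv (fun t => x t - y t) =ᶠ[nhds t] fun t => deriv x t - deriv y t := by
    filter_upwards [Ioo_mem_nhds ht.1 ht.2] with s hs
    exact deriv_fun_sub (hx.interior hs).1 (hy.interior hs).1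
  obtain ⟨-, hdx, hex⟩ := hx.interior ht
  obtain ⟨-, hdy, hey⟩ := hy.interior ht
  rw [hev.eq_of_nhds, sub_eq_zero] at hcrit
  rw [hev.deriv_eq, deriv_fun_sub hdx hdy, hex, hey, hcrit]
  have : Real.exp (-t * x t) < Real.exp (-t * y t) :=
    Real.exp_lt_exp.2 (by nlinarith [ht.1])
  linarith

/-- The paper's illustrative example: the boundary value problem
`x'' + sin(x') + e^{−t·x} = 0`, `x(1) = x(2) = 0` has a unique solution on `[1,2]`. -/
theorem example_bvp_existence_uniqueness :
    (∃ x : ℝ → ℝ, IsExampleBVPSolution x) ∧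
      ∀ x y : ℝ → ℝ, IsExampleBVPSolution x → IsExampleBVPSolution y →
        EqOn x y (Icc (1 : ℝ) 2) :=
  ⟨exists_isExampleBVPSolution,
    fun _ _ hx hy t ht => le_antisymm (hx.le hy t ht) (hy.le hx t ht)⟩
end

section
/- Let a, g : ℝ × ℝ → ℝ be continuously differentiable, let x : ℝ → ℝ be continuously differentiable, and let C₀, C₁, C₂, C₃, C₄, C₅, A₁ ≥ 0 be constants such that for all 0 ≤ t < 1: |a(t, x(t))| ≤ C₀, |∂a/∂t(t, x(t))| ≤ C₁, |∂a/∂x(t, x(t))| ≤ C₂, |g(t, x(t))| ≤ C₃, |∂g/∂t(t, x(t))| ≤ C₄, |∂g/∂x(t, x(t))| ≤ C₅, and |x'(t)| ≤ A₁. Then there exists a constant D₁ ≥ 0, depending only on C₀, C₁, C₂, C₃, C₄, C₅ and A₁, such that for all 0 ≤ tₙ < t_{n+1} < 1, writing h = t_{n+1} − tₙ and E(u) = −(∂a/∂t)(u,x(u))·x'(u)/(1−u) − a(u,x(u))·x'(u)/(1−u)² + (∂g/∂t)(u,x(u)) − (∂a/∂x)(u,x(u))·x'(u)²/(1−u) +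 (∂g/∂x)(u,x(u))·x'(u) + a(u,x(u))²·x'(u)/(1−u)² − a(u,x(u))·g(u,x(u))/(1−u), one has ( ∫_{tₙ}^{t_{n+1}} ∫_{tₙ}^{t} E(u) du dt )² ≤ D₁ · h⁴/(1−t_{n+1})⁴. -/
/-- Iterating the trivial bound on an interval integral: a function bounded by `M` on `(a, b]`
has double primitive at most `M * (b - a) ^ 2`. -/
theorem abs_integral_integral_le_of_abs_le_const {f : ℝ → ℝ} {a b M : ℝ} (hab : a ≤ b)
    (hM : 0 ≤ M) (hf : ∀ u, a < u → u ≤ b → |f u| ≤ M) :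
    |∫ t in a..b, ∫ u in a..t, f u| ≤ M * (b - a) ^ 2 := by
  have inner : ∀ t ∈ Set.uIoc a b, ‖∫ u in a..t, f u‖ ≤ M * (b - a) := by
    intro t ht
    rw [Set.uIoc_of_le hab] at ht
    have h : ‖∫ u in a..t, f u‖ ≤ M * |t - a| := by
      refine intervalIntegral.norm_integral_le_of_norm_le_const fun u hu => ?_
      rw [Set.uIoc_of_le ht.1.le] at hu
      exact hf u hu.1 (hu.2.trans ht.2)
    rw [abs_of_nonneg (sub_nonneg.2 ht.1.le)] at h
    exact h.trans (mul_le_mul_of_nonneg_left (by linarith [ht.2]) hM)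
  have outer := intervalIntegral.norm_integral_le_of_norm_le_const inner
  rw [Real.norm_eq_abs, abs_of_nonneg (sub_nonneg.2 hab)] at outer
  exact outer.trans_eq (by ring)

/-- The expanded integrand of the truncation error, as a function of the values of the
coefficients, is bounded by a constant over `d ^ 2` as long as `d ≤ r ≤ 1`. -/
theorem abs_truncation_integrand_le {C₀ C₁ C₂ C₃ C₄ C₅ A₁ : ℝ}
    {α αt αx γ γt γx v r d : ℝ} (hα : |α| ≤ C₀) (hαt : |αt| ≤ C₁) (hαx : |αx| ≤ C₂)
    (hγ : |γ| ≤ C₃) (hγt : |γt| ≤ C₄) (hγx : |γx| ≤ C₅) (hv : |v| ≤ A₁)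
    (hd : 0 < d) (hdr : d ≤ r) (hr : r ≤ 1) :
    |-αt * v / r - α * v / r ^ 2 + γt - αx * v ^ 2 / r + γx * v + α ^ 2 * v / r ^ 2 - α * γ / r| ≤
      (C₁ * A₁ + C₀ * A₁ + C₄ + C₂ * A₁ ^ 2 + C₅ * A₁ + C₀ ^ 2 * A₁ + C₀ * C₃) / d ^ 2 := by
  have hC₀ := (abs_nonneg _).trans hα
  have hC₁ := (abs_nonneg _).trans hαt
  have hC₂ := (abs_nonneg _).trans hαx
  have hC₅ := (abs_nonneg _).trans hγx
  have div_le : ∀ {p P q : ℝ}, |p| ≤ P → d ^ 2 ≤ q → |p / q| ≤ P / d ^ 2 := by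
    intro p P q hp hq
    rw [abs_div, abs_of_pos ((pow_pos hd 2).trans_le hq)]
    exact div_le_div₀ ((abs_nonneg _).trans hp) hp (pow_pos hd 2) hq
  have hr1 : d ^ 2 ≤ r := by nlinarith
  have hr2 : d ^ 2 ≤ r ^ 2 := by gcongr
  have h1 : d ^ 2 ≤ 1 := hr1.trans hr
  have e₁ : |-αt * v / r| ≤ C₁ * A₁ / d ^ 2 :=
    div_le (by rw [abs_mul, abs_neg]; gcongr) hr1
  have e₂ : |α * v / r ^ 2| ≤ C₀ * A₁ / d ^ 2 := div_le (by rw [abs_mul]; gcongr) hr2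
  have e₃ : |γt / 1| ≤ C₄ / d ^ 2 := div_le hγt h1
  have e₄ : |αx * v ^ 2 / r| ≤ C₂ * A₁ ^ 2 / d ^ 2 :=
    div_le (by rw [abs_mul, abs_pow]; gcongr) hr1
  have e₅ : |γx * v / 1| ≤ C₅ * A₁ / d ^ 2 := div_le (by rw [abs_mul]; gcongr) h1
  have e₆ : |α ^ 2 * v / r ^ 2| ≤ C₀ ^ 2 * A₁ / d ^ 2 :=
    div_le (by rw [abs_mul, abs_pow]; gcongr) hr2
  have e₇ : |α * γ / r| ≤ C₀ * C₃ / d ^ 2 := div_le (by rw [abs_mul]; gcongr) hr1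
  rw [div_one] at e₃ e₅
  simp only [add_div]
  rw [abs_le] at *
  constructor <;> linarith

/-- Bound `(L⁽¹⁾ₙ)² ≤ D₁·h⁴/(1−t_{n+1})⁴` on the squared local truncation error of the
Euler update for `x'`: there is a constant `D₁ ≥ 0`, depending only on the constants
`C₀, …, C₅, A₁`, such that for all continuously differentiable `a`, `g`, `x` satisfying the
stated bounds on `[0,1)`, and all `0 ≤ tₙ < t_{n+1} < 1` with `h = t_{n+1} − tₙ`, the square
of the double integral of the integrand
`E(u) = ∂â/∂t + (∂â/∂x)·x' + (∂â/∂x')·â` (expanded explicitly below) is at most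
`D₁·h⁴/(1−t_{n+1})⁴`. -/
theorem L1_truncation_bound (C₀ C₁ C₂ C₃ C₄ C₅ A₁ : ℝ)
    (hC₀ : 0 ≤ C₀) (hC₁ : 0 ≤ C₁) (hC₂ : 0 ≤ C₂) (hC₃ : 0 ≤ C₃)
    (hC₄ : 0 ≤ C₄) (hC₅ : 0 ≤ C₅) (hA₁ : 0 ≤ A₁) :
    ∃ D₁ : ℝ, 0 ≤ D₁ ∧
      ∀ (a g : ℝ → ℝ → ℝ) (x : ℝ → ℝ),
        ContDiff ℝ 1 (fun p : ℝ × ℝ => a p.1 p.2) →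
        ContDiff ℝ 1 (fun p : ℝ × ℝ => g p.1 p.2) →
        ContDiff ℝ 1 x →
        (∀ t : ℝ, 0 ≤ t → t < 1 →
          |a t (x t)| ≤ C₀ ∧ |deriv (fun s => a s (x t)) t| ≤ C₁ ∧
          |deriv (a t) (x t)| ≤ C₂ ∧ |g t (x t)| ≤ C₃ ∧
          |deriv (fun s => g s (x t)) t| ≤ C₄ ∧ |deriv (g t) (x t)| ≤ C₅ ∧
          |deriv x t| ≤ A₁) →
        ∀ tn tn1 : ℝ, 0 ≤ tn → tn < tn1 → tn1 < 1 →
          (∫ t in tn..tn1, ∫ u in tn..t,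
              (-(deriv (fun s => a s (x u)) u) * deriv x u / (1 - u)
                - a u (x u) * deriv x u / (1 - u) ^ 2
                + deriv (fun s => g s (x u)) u
                - deriv (a u) (x u) * (deriv x u) ^ 2 / (1 - u)
                + deriv (g u) (x u) * deriv x u
                + (a u (x u)) ^ 2 * deriv x u / (1 - u) ^ 2
                - a u (x u) * g u (x u) / (1 - u))) ^ 2 ≤
            D₁ * (tn1 - tn) ^ 4 / (1 - tn1) ^ 4 := by
  set K := C₁ * A₁ + C₀ * A₁ + C₄ + C₂ * A₁ ^ 2 + C₅ * A₁ + C₀ ^ 2 * A₁ + C₀ * C₃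
  have hK0 : 0 ≤ K := by positivity
  refine ⟨K ^ 2, sq_nonneg K, ?_⟩
  intro a g x _ _ _ hbound tn tn1 h0 hlt h1
  have hd : 0 < 1 - tn1 := sub_pos.2 h1
  rw [← sq_abs]
  refine (pow_le_pow_left₀ (abs_nonneg _) (abs_integral_integral_le_of_abs_le_const
    (M := K / (1 - tn1) ^ 2) hlt.le (by positivity) fun u hu hu' => ?_) 2).trans_eq ?_
  · obtain ⟨b₀, b₁, b₂, b₃, b₄, b₅, b₆⟩ := hbound u (by linarith) (by linarith)
    exact abs_truncation_integrand_le b₀ b₁ b₂ b₃ b₄ b₅ b₆ hd (by linarith) (by linarith)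
  · field_simp
end
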